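/- Let c ≥ 0 be a fixed integer. Then lim_{n→∞} Q_n(n−c, n−c) / C_n = Σ_{s=0}^{c} ((s+1)/(2c+1−s))² · binom(2c+1−s, c+1)² · 4^{s−2c−1}. -/

import Mathlib

open Filter Finset Real

/-- `σ` contains the pattern `τ`. -/
def ContainsPattern {n m : ℕ} (σ : Equiv.Perm (Fin n)) (τ : Equiv.Perm (Fin m)) : Prop :=
  ∃ f : Fin m → Fin n, StrictMono f ∧ ∀ a b : Fin m, σ (f a) < σ (f b) ↔ τ a < τ b

/-- `σ` avoids the pattern `τ`. -/
def Avoids {n m : ℕ} (σ : Equiv.Perm (Fin n)) (τ : Equiv.Perm (Fin m)) : Prop :=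
  ¬ ContainsPattern σ τ

/-- The pattern (1,2,3) ∈ S₃ (0-indexed: 0,1,2). -/
def pattern123 : Equiv.Perm (Fin 3) := 1

/-- The pattern (1,3,2) ∈ S₃ (0-indexed: 0,2,1). -/
def pattern132 : Equiv.Perm (Fin 3) := Equiv.swap 1 2

/-- The pattern (3,2,1) ∈ S₃ (0-indexed: 2,1,0). -/
def pattern321 : Equiv.Perm (Fin 3) := Equiv.swap 0 2

/-- The pattern (2,3,1) ∈ S₃ (0-indexed: 1,2,0). -/
def pattern231 : Equiv.Perm (Fin 3) := (Equiv.swap 1 2).trans (Equiv.swap 0 1)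

/-- `P_n(j,k)`: the number of 123-avoiding permutations of `{1,…,n}` with value `k`
in position `j` (1-indexed). -/
noncomputable def Pcount (n j k : ℕ) : ℕ :=
  Nat.card {σ : Equiv.Perm (Fin n) //
    Avoids σ pattern123 ∧ ∃ i : Fin n, (i : ℕ) + 1 = j ∧ (σ i : ℕ) + 1 = k}

/-- `Q_n(j,k)`: the number of 132-avoiding permutations of `{1,…,n}` with value `k`
in position `j` (1-indexed). -/
noncomputable def Qcount (n j k : ℕ) : ℕ :=
  Nat.card {σ : Equiv.Perm (Fin n) //
    Avoids σ pattern132 ∧ ∃ i : Fin n, (i : ℕ) + 1 = j ∧ (σ i : ℕ) + 1 = k}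

/-- Ballot numbers, by iterated Catalan convolution. -/
def ballotB : ℕ → ℕ → ℕ
  | 0, y => catalan y
  | s + 1, y => ∑ b ∈ Finset.range y, catalan b * ballotB s (y - 1 - b)

theorem ballotB_zero (y : ℕ) : ballotB 0 y = catalan y := by simp [ballotB]

theorem ballotB_succ (s y : ℕ) : ballotB (s + 1) y =
    ∑ b ∈ Finset.range y, catalan b * ballotB s (y - 1 - b) := by simp [ballotB]

theorem ballotB_succ_zero (s : ℕ) : ballotB (s + 1) 0 = 0 := by simp [ballotB]

theorem ballotB_one_succ (y : ℕ) : ballotB 1 (y + 1) = ballotB 0 (y + 1) := by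
  rw [ballotB_succ, ballotB_zero, catalan_succ', Finset.Nat.sum_antidiagonal_eq_sum_range_succ_mk]
  refine Finset.sum_congr rfl fun b hb => ?_
  simp [ballotB_zero]

theorem ballotB_rec (s : ℕ) : ∀ y, ballotB (s + 1) (y + 1) = ballotB (s + 2) (y + 1) + ballotB s y := by
  induction s with
  | zero =>
    intro y
    rw [ballotB_succ 0, ballotB_succ 1, Finset.sum_range_succ, Finset.sum_range_succ]
    have : ∀ b ∈ Finset.range y, catalan b * ballotB 0 (y + 1 - 1 - b)
        = catalan b * ballotB (0 + 1) (y + 1 - 1 - b) := by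
      intro b hb
      have hb' := Finset.mem_range.1 hb
      obtain ⟨k, hk⟩ : ∃ k, y + 1 - 1 - b = k + 1 := ⟨y - b - 1, by omega⟩
      rw [hk, ← ballotB_one_succ]
    rw [Finset.sum_congr rfl this]
    simp [ballotB_zero, ballotB_succ_zero]
  | succ s ih =>
    intro y
    rw [ballotB_succ (s + 1), ballotB_succ (s + 2), ballotB_succ s, Finset.sum_range_succ,
      Finset.sum_range_succ]
    have : ∀ b ∈ Finset.range y, catalan b * ballotB (s + 1) (y + 1 - 1 - b)
        = catalan b * ballotB (s + 2) (y + 1 - 1 - b) + catalan b * ballotB s (y - 1 - b) := by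
      intro b hb
      have hb' := Finset.mem_range.1 hb
      obtain ⟨k, hk⟩ : ∃ k, y + 1 - 1 - b = k + 1 := ⟨y - b - 1, by omega⟩
      rw [hk, show y - 1 - b = k by omega, ih]
      ring
    rw [Finset.sum_congr rfl this, Finset.sum_add_distrib]
    simp [ballotB_succ_zero]

theorem ballotB_eq_zero (s : ℕ) : ∀ y, y < s → ballotB s y = 0 := by
  induction s with
  | zero => intro y hy; omega
  | succ s ih =>
    intro y hy
    rw [ballotB_succ]
    refine Finset.sum_eq_zero fun b hb => ?_
    have hb' := Finset.mem_range.1 hb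
    rw [ih _ (by omega), mul_zero]

theorem catalan_fact (m : ℕ) :
    catalan m * (Nat.factorial m * Nat.factorial (m + 1)) = Nat.factorial (2 * m) := by
  have h1 := succ_mul_catalan_eq_centralBinom m
  have h2 := Nat.choose_mul_factorial_mul_factorial (n := 2 * m) (k := m) (by omega)
  rw [show 2 * m - m = m by omega, ← Nat.centralBinom_eq_two_mul_choose, ← h1] at h2
  rw [← h2, Nat.factorial_succ]
  ring

theorem ballotB_fact (s : ℕ) : ∀ m, ballotB s (m + s) * (Nat.factorial m * Nat.factorial (m + s + 1))
    = (s + 1) * Nat.factorial (2 * m + s) := by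
  induction s using Nat.twoStepInduction with
  | zero => intro m; simpa [ballotB_zero] using catalan_fact m
  | one =>
    intro m
    rw [ballotB_one_succ, ballotB_zero]
    have := catalan_fact (m + 1)
    rw [show 2 * (m + 1) = (2 * m + 1) + 1 by ring, Nat.factorial_succ (2 * m + 1),
      Nat.factorial_succ m] at this
    have h : (m + 1) * (catalan (m + 1) * (Nat.factorial m * Nat.factorial (m + 1 + 1)))
        = (m + 1) * ((1 + 1) * Nat.factorial (2 * m + 1)) := by
      nlinarith [this]
    exact Nat.eq_of_mul_eq_mul_left (Nat.succ_pos m) h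
  | more s ih1 ih2 =>
    intro m
    have h1 := ih1 (m + 1)
    have h2 := ih2 (m + 1)
    have h3 := ballotB_rec s (m + s + 1)
    rw [show m + 1 + s = m + s + 1 by ring, show 2 * (m + 1) + s = 2 * m + s + 2 by ring] at h1
    rw [show m + 1 + (s + 1) = m + s + 1 + 1 by ring, show 2 * (m + 1) + (s + 1) = (2 * m + s + 2) + 1 by ring,
      Nat.factorial_succ (2 * m + s + 2), Nat.factorial_succ (m + s + 1 + 1), h3] at h2
    rw [show m + (s + 2) = m + s + 1 + 1 by ring, show 2 * m + (s + 2) = 2 * m + s + 2 by ring,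
      Nat.factorial_succ (m + s + 1 + 1)]
    rw [Nat.factorial_succ m] at h1 h2
    have hm : (0:ℤ) < m + 1 := by positivity
    generalize Nat.factorial m = M at *
    generalize Nat.factorial (m + s + 1 + 1) = A at *
    generalize Nat.factorial (2 * m + s + 2) = D at *
    generalize ballotB s (m + s + 1) = X at *
    generalize ballotB (s + 2) (m + s + 1 + 1) = Y at *
    zify at *
    refine mul_left_cancel₀ hm.ne' ?_
    linear_combination h2 - ((m : ℤ) + s + 3) * h1

/-- Unnormalised limit. -/
noncomputable def limG (x y : ℕ) : ℝ :=
  ∑ s ∈ Finset.range (y + 1), 4 ^ s * (ballotB s x : ℝ) * ballotB s y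

theorem limG_ext (x y N : ℕ) (h : y + 1 ≤ N) :
    limG x y = ∑ s ∈ Finset.range N, 4 ^ s * (ballotB s x : ℝ) * ballotB s y := by
  unfold limG
  refine Finset.sum_subset (by simpa using h) fun s _ hs => ?_
  rw [ballotB_eq_zero s y (by simpa using hs)]
  simp

theorem limG_zero (x : ℕ) : limG x 0 = catalan x := by
  simp [limG, ballotB_zero]

theorem limG_succ (x y : ℕ) : limG x (y + 1) =
    4 * ∑ b ∈ Finset.range x, (catalan b : ℝ) * limG (x - 1 - b) y
    + ∑ a ∈ Finset.range (y + 1), (catalan a : ℝ) * limG x (y - a) := by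
  have e1 : ∑ b ∈ Finset.range x, (catalan b : ℝ) * limG (x - 1 - b) y =
      ∑ s ∈ Finset.range (y + 1), 4 ^ s * (ballotB (s + 1) x : ℝ) * ballotB s y := by
    simp only [limG, Finset.mul_sum]
    rw [Finset.sum_comm]
    refine Finset.sum_congr rfl fun s _ => ?_
    rw [ballotB_succ]
    push_cast
    rw [Finset.mul_sum, Finset.sum_mul]
    refine Finset.sum_congr rfl fun b _ => ?_
    ring
  have e2 : ∑ a ∈ Finset.range (y + 1), (catalan a : ℝ) * limG x (y - a) =
      ∑ s ∈ Finset.range (y + 2), 4 ^ s * (ballotB s x : ℝ) * ballotB (s + 1) (y + 1) := by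
    have : ∀ a ∈ Finset.range (y + 1), (catalan a : ℝ) * limG x (y - a) =
      ∑ s ∈ Finset.range (y + 2), (catalan a : ℝ) * (4 ^ s * (ballotB s x : ℝ) * ballotB s (y - a)) := by
      intro a _
      rw [limG_ext x (y - a) (y + 2) (by omega), Finset.mul_sum]
    rw [Finset.sum_congr rfl this, Finset.sum_comm]
    refine Finset.sum_congr rfl fun s _ => ?_
    rw [ballotB_succ]
    push_cast
    rw [Finset.mul_sum]
    refine Finset.sum_congr rfl fun b _ => ?_
    ring
  rw [e1, e2, limG, Finset.sum_range_succ', Finset.sum_range_succ' _ (y + 1), ballotB_one_succ,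
    ← add_assoc, Finset.mul_sum, ← Finset.sum_add_distrib]
  congr 1
  refine Finset.sum_congr rfl fun s _ => ?_
  rw [ballotB_rec]
  push_cast
  ring

theorem limG_closed (c : ℕ) : limG c c / 4 ^ (c + c + 1) = ∑ s ∈ Finset.range (c + 1),
        (((s : ℝ) + 1) / (2 * (c : ℝ) + 1 - s)) ^ 2 *
          (Nat.choose (2 * c + 1 - s) (c + 1) : ℝ) ^ 2 *
          (4 : ℝ) ^ ((s : ℤ) - 2 * (c : ℤ) - 1) := by
  rw [limG, Finset.sum_div]
  refine Finset.sum_congr rfl fun s hs => ?_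
  obtain ⟨m, rfl⟩ : ∃ m, c = m + s := ⟨c - s, by have := Finset.mem_range.1 hs; omega⟩
  have h1 := ballotB_fact s m
  have h2 := Nat.choose_mul_factorial_mul_factorial (n := 2 * m + s + 1) (k := m + s + 1) (by omega)
  rw [show 2 * m + s + 1 - (m + s + 1) = m by omega, Nat.factorial_succ (2 * m + s)] at h2
  rw [show 2 * (m + s) + 1 - s = 2 * m + s + 1 by omega]
  have h3 : (ballotB s (m + s) : ℝ) * (2 * m + s + 1) =
      (s + 1) * (Nat.choose (2 * m + s + 1) (m + s + 1)) := by
    have h4 : (0:ℝ) < Nat.factorial m * Nat.factorial (m + s + 1) := by positivity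
    refine mul_left_cancel₀ h4.ne' ?_
    have h1' : (ballotB s (m + s) : ℝ) * (Nat.factorial m * Nat.factorial (m + s + 1))
      = (s + 1) * Nat.factorial (2 * m + s) := by exact_mod_cast h1
    have h2' : (Nat.choose (2 * m + s + 1) (m + s + 1) : ℝ) * Nat.factorial (m + s + 1) * Nat.factorial m
      = (2 * m + s + 1) * Nat.factorial (2 * m + s) := by exact_mod_cast h2
    linear_combination (2 * (m:ℝ) + s + 1) * h1' - ((s:ℝ) + 1) * h2'
  have h5 : (0:ℝ) < 2 * m + s + 1 := by positivity
  have h6 : (2 * ((m + s : ℕ) : ℝ) + 1 - s) = 2 * m + s + 1 := by push_cast; ring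
  have h7 : (ballotB s (m + s) : ℝ) = (s + 1) / (2 * m + s + 1) * (Nat.choose (2 * m + s + 1) (m + s + 1)) := by
    rw [div_mul_eq_mul_div, eq_div_iff h5.ne', h3]
  rw [h6, h7]
  have h8 : (4 : ℝ) ^ ((s : ℤ) - 2 * ((m + s : ℕ) : ℤ) - 1) = 4 ^ s / 4 ^ (m + s + (m + s) + 1) := by
    rw [eq_div_iff (by positivity), ← zpow_natCast, ← zpow_natCast, ← zpow_add₀ (by norm_num)]
    congr 1
    push_cast
    ring
  rw [h8]
  ring

theorem catalan_pos' (n : ℕ) : 0 < catalan n := by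
  have := succ_mul_catalan_eq_centralBinom n
  have h := Nat.centralBinom_pos n
  rw [← this] at h
  exact Nat.pos_of_mul_pos_left h

theorem catalan_ratio_one :
    Tendsto (fun n : ℕ => (catalan n : ℝ) / catalan (n + 1)) atTop (nhds (1 / 4)) := by
  have h : ∀ n : ℕ, (catalan n : ℝ) / catalan (n + 1) = 1 / 4 + (3 / 8) * (1 / ((n : ℝ) + 1 / 2)) := by
    intro n
    have h1 := succ_mul_catalan_eq_centralBinom n
    have h2 := succ_mul_catalan_eq_centralBinom (n + 1)
    have h3 := Nat.succ_mul_centralBinom_succ n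
    rw [← h1, ← h2] at h3
    have h3' : ((n : ℝ) + 1) * ((n + 1 + 1) * catalan (n + 1)) = 2 * (2 * n + 1) * ((n + 1) * catalan n) := by
      exact_mod_cast h3
    have h4 : ((n : ℝ) + 1 + 1) * catalan (n + 1) = 2 * (2 * n + 1) * catalan n := by
      refine mul_left_cancel₀ (by positivity : (n : ℝ) + 1 ≠ 0) ?_
      linear_combination h3'
    have h5 : (0 : ℝ) < catalan (n + 1) := by exact_mod_cast catalan_pos' _
    have h6 : (n : ℝ) + 1 / 2 ≠ 0 := by positivity
    rw [div_eq_iff h5.ne']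
    field_simp
    linear_combination (-16) * h4
  simp_rw [h]
  have : Tendsto (fun n : ℕ => (n : ℝ) + 1 / 2) atTop atTop :=
    tendsto_atTop_add_const_right _ _ tendsto_natCast_atTop_atTop
  have h2 := (this.inv_tendsto_atTop.const_mul (3 / 8 : ℝ)).const_add (1 / 4 : ℝ)
  simpa using h2

theorem catalan_ratio (k : ℕ) :
    Tendsto (fun n : ℕ => (catalan n : ℝ) / catalan (n + k)) atTop (nhds (1 / 4 ^ k)) := by
  induction k with
  | zero =>
    have : ∀ n, (catalan n : ℝ) / catalan (n + 0) = 1 := fun n =>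
      div_self (by exact_mod_cast (catalan_pos' n).ne')
    simp_rw [this]
    simp
  | succ k ih =>
    have h := ih.mul (catalan_ratio_one.comp (tendsto_add_atTop_nat k))
    have e : (1 : ℝ) / 4 ^ k * (1 / 4) = 1 / 4 ^ (k + 1) := by rw [pow_succ]; field_simp
    rw [e] at h
    refine h.congr fun n => ?_
    have h5 : (catalan (n + k) : ℝ) ≠ 0 := by exact_mod_cast (catalan_pos' _).ne'
    simp only [Function.comp_apply]
    rw [div_mul_div_cancel₀ h5, add_assoc]

theorem tendsto_step (u : ℕ → ℝ) (l : ℝ) (k : ℕ)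
    (h : Tendsto (fun n => u n / catalan n) atTop (nhds l)) :
    Tendsto (fun n => u (n - k) / catalan (n + 1)) atTop (nhds (l / 4 ^ (k + 1))) := by
  rw [← tendsto_add_atTop_iff_nat k]
  have := h.mul (catalan_ratio (k + 1))
  rw [mul_one_div] at this
  refine this.congr fun n => ?_
  have h5 : (catalan n : ℝ) ≠ 0 := by exact_mod_cast (catalan_pos' _).ne'
  rw [div_mul_div_cancel₀ h5, Nat.add_sub_cancel, add_assoc]

theorem limit_of_rec (F : ℕ → ℕ → ℕ → ℕ)
    (h0 : ∀ n x, x ≤ n → F (n + 1) x 0 = catalan x * catalan (n - x))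
    (h1 : ∀ n x y, x + y < n → F (n + 1) x (y + 1) =
      ∑ b ∈ Finset.range x, catalan b * F (n - b) (x - 1 - b) y
      + ∑ a ∈ Finset.range (y + 1), catalan a * F (n - a) x (y - a)) (y : ℕ) :
    ∀ x, Tendsto (fun n => (F n x y : ℝ) / catalan n) atTop (nhds (limG x y / 4 ^ (x + y + 1))) := by
  induction y using Nat.strong_induction_on with
  | _ y ih =>
  intro x
  rw [← tendsto_add_atTop_iff_nat 1]
  cases y with
  | zero =>
    have h := tendsto_step (fun n => (catalan n : ℝ)) 1 x (by simpa using catalan_ratio 0)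
    have h' := h.const_mul (catalan x : ℝ)
    rw [limG_zero, add_zero, div_eq_mul_one_div]
    refine h'.congr' ?_
    filter_upwards [eventually_ge_atTop x] with n hn
    rw [h0 n x hn]
    push_cast
    ring
  | succ y =>
    have ha := tendsto_finsetSum (Finset.range x) (fun b _ =>
      (tendsto_step (fun n => (F n (x - 1 - b) y : ℝ)) _ b (ih y (by omega) (x - 1 - b))).const_mul
        (catalan b : ℝ))
    have hb := tendsto_finsetSum (Finset.range (y + 1)) (fun a _ =>
      (tendsto_step (fun n => (F n x (y - a) : ℝ)) _ a (ih (y - a) (by omega) x)).const_mul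
        (catalan a : ℝ))
    have h := ha.add hb
    have e : limG x (y + 1) / 4 ^ (x + (y + 1) + 1) =
      ∑ b ∈ Finset.range x, (catalan b : ℝ) * (limG (x - 1 - b) y / 4 ^ (x - 1 - b + y + 1) / 4 ^ (b + 1))
      + ∑ a ∈ Finset.range (y + 1), (catalan a : ℝ) * (limG x (y - a) / 4 ^ (x + (y - a) + 1) / 4 ^ (a + 1)) := by
      rw [limG_succ, add_div, Finset.mul_sum, Finset.sum_div, Finset.sum_div]
      congr 1
      · refine Finset.sum_congr rfl fun b hb => ?_
        have hb' := Finset.mem_range.1 hb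
        rw [div_div, ← pow_add, show x + (y + 1) + 1 = (x - 1 - b + y + 1 + (b + 1)) + 1 by omega, pow_succ]
        field_simp
      · refine Finset.sum_congr rfl fun a ha => ?_
        have ha' := Finset.mem_range.1 ha
        rw [div_div, ← pow_add, show x + (y + 1) + 1 = (x + (y - a) + 1 + (a + 1)) by omega]
        ring
    rw [e]
    refine h.congr' ?_
    filter_upwards [eventually_gt_atTop (x + y)] with n hn
    rw [h1 n x y hn]
    push_cast
    rw [add_div, Finset.sum_div, Finset.sum_div]
    simp only [mul_div_assoc]

/-- Elementary form of 132-avoidance. -/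
def Av {n : ℕ} (σ : Equiv.Perm (Fin n)) : Prop :=
  ∀ i j k : Fin n, i < j → j < k → ¬ (σ i < σ k ∧ σ k < σ j)

theorem avoids_iff {n : ℕ} (σ : Equiv.Perm (Fin n)) : Avoids σ pattern132 ↔ Av σ := by
  unfold Avoids ContainsPattern Av
  constructor
  · intro h i j k hij hjk hh
    apply h
    refine ⟨![i, j, k], ?_, ?_⟩
    · intro a b hab
      fin_cases a <;> fin_cases b <;> simp_all
      exact hij.trans hjk
    · intro a b
      have h1 := hh.1
      have h2 := hh.2
      have h3 := h1.trans h2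
      fin_cases a <;> fin_cases b <;>
        simp [pattern132, Equiv.swap_apply_def, h1, h2, h3, h1.le, h2.le, h3.le]
  · rintro h ⟨f, hf, hh⟩
    refine h (f 0) (f 1) (f 2) (hf (by decide)) (hf (by decide)) ⟨(hh 0 2).2 ?_, (hh 2 1).2 ?_⟩
    · simp [pattern132, Equiv.swap_apply_def]
    · simp [pattern132, Equiv.swap_apply_def]

/-- Underlying function of the gluing `L ⊕ max ⊕ R`. -/
def glueFun {a b N : ℕ} (h : a + b + 1 = N) (L : Equiv.Perm (Fin a)) (R : Equiv.Perm (Fin b))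
    (i : Fin N) : Fin N :=
  if h1 : (i : ℕ) < a then ⟨L ⟨i, h1⟩ + b, by have := (L ⟨i, h1⟩).2; omega⟩
  else if h2 : (i : ℕ) = a then ⟨a + b, by omega⟩
  else ⟨R ⟨i - a - 1, by have := i.2; omega⟩, by
    have := (R ⟨i - a - 1, by have := i.2; omega⟩).2; omega⟩

theorem glueFun_lt {a b N : ℕ} (h : a + b + 1 = N) (L : Equiv.Perm (Fin a)) (R : Equiv.Perm (Fin b))
    (i : Fin N) (h1 : (i : ℕ) < a) : (glueFun h L R i : ℕ) = L ⟨i, h1⟩ + b := by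
  simp [glueFun, h1]

theorem glueFun_eq {a b N : ℕ} (h : a + b + 1 = N) (L : Equiv.Perm (Fin a)) (R : Equiv.Perm (Fin b))
    (i : Fin N) (h1 : (i : ℕ) = a) : (glueFun h L R i : ℕ) = a + b := by
  simp [glueFun, h1]

theorem glueFun_gt {a b N : ℕ} (h : a + b + 1 = N) (L : Equiv.Perm (Fin a)) (R : Equiv.Perm (Fin b))
    (i : Fin N) (h1 : a < (i : ℕ)) : (glueFun h L R i : ℕ) = R ⟨i - a - 1, by have := i.2; omega⟩ := by
  have h2 : ¬ (i : ℕ) < a := by omega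
  have h3 : ¬ (i : ℕ) = a := by omega
  simp [glueFun, h2, h3]

theorem glueFun_inj {a b N : ℕ} (h : a + b + 1 = N) (L : Equiv.Perm (Fin a)) (R : Equiv.Perm (Fin b)) :
    Function.Injective (glueFun h L R) := by
  intro i j hij
  have hv : (glueFun h L R i : ℕ) = glueFun h L R j := by rw [hij]
  rcases lt_trichotomy (i : ℕ) a with hi | hi | hi <;> rcases lt_trichotomy (j : ℕ) a with hj | hj | hj
  · rw [glueFun_lt h L R i hi, glueFun_lt h L R j hj] at hv
    have := L.injective (Fin.ext (by omega) : L ⟨i, hi⟩ = L ⟨j, hj⟩)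
    simpa [Fin.ext_iff] using this
  · rw [glueFun_lt h L R i hi, glueFun_eq h L R j hj] at hv; omega
  · rw [glueFun_lt h L R i hi, glueFun_gt h L R j hj] at hv; omega
  · rw [glueFun_eq h L R i hi, glueFun_lt h L R j hj] at hv; omega
  · exact Fin.ext (by omega)
  · rw [glueFun_eq h L R i hi, glueFun_gt h L R j hj] at hv; omega
  · rw [glueFun_gt h L R i hi, glueFun_lt h L R j hj] at hv; omega
  · rw [glueFun_gt h L R i hi, glueFun_eq h L R j hj] at hv; omega
  · rw [glueFun_gt h L R i hi, glueFun_gt h L R j hj] at hv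
    have := R.injective (Fin.ext hv)
    simp only [Fin.mk.injEq] at this
    exact Fin.ext (by omega)

/-- The gluing `L ⊕ max ⊕ R`. -/
noncomputable def glue {a b N : ℕ} (h : a + b + 1 = N) (L : Equiv.Perm (Fin a)) (R : Equiv.Perm (Fin b)) :
    Equiv.Perm (Fin N) :=
  Equiv.ofBijective _ (Finite.injective_iff_bijective.1 (glueFun_inj h L R))

theorem glue_apply {a b N : ℕ} (h : a + b + 1 = N) (L : Equiv.Perm (Fin a)) (R : Equiv.Perm (Fin b))
    (i : Fin N) : glue h L R i = glueFun h L R i := rfl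

theorem glue_av {a b N : ℕ} (h : a + b + 1 = N) (L : Equiv.Perm (Fin a)) (R : Equiv.Perm (Fin b))
    (hL : Av L) (hR : Av R) : Av (glue h L R) := by
  intro i j k hij hjk hh
  simp only [glue_apply, Fin.lt_def] at hh hij hjk
  obtain ⟨h1, h2⟩ := hh
  rcases lt_trichotomy (k : ℕ) a with hk | hk | hk
  · rw [glueFun_lt h L R k hk] at h1 h2
    rw [glueFun_lt h L R i (by omega)] at h1
    rw [glueFun_lt h L R j (by omega)] at h2
    exact hL ⟨i, by omega⟩ ⟨j, by omega⟩ ⟨k, hk⟩ hij hjk ⟨Fin.lt_def.2 (by omega), Fin.lt_def.2 (by omega)⟩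
  · rw [glueFun_eq h L R k hk] at h2
    have := (glueFun h L R j).2
    omega
  · rw [glueFun_gt h L R k hk] at h1 h2
    rcases lt_trichotomy (i : ℕ) a with hi | hi | hi
    · rw [glueFun_lt h L R i hi] at h1; omega
    · rw [glueFun_eq h L R i hi] at h1; omega
    · rw [glueFun_gt h L R i hi] at h1
      rw [glueFun_gt h L R j (by omega)] at h2
      exact hR ⟨i - a - 1, by have := i.2; omega⟩ ⟨j - a - 1, by have := j.2; omega⟩
        ⟨k - a - 1, by have := k.2; omega⟩ (Fin.lt_def.2 (by simp only; omega))
        (Fin.lt_def.2 (by simp only; omega))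
        ⟨Fin.lt_def.2 h1, Fin.lt_def.2 h2⟩

theorem glue_surj {a b N : ℕ} (h : a + b + 1 = N) (σ : Equiv.Perm (Fin N)) (hσ : Av σ)
    (hmax : (σ ⟨a, by omega⟩ : ℕ) = a + b) :
    ∃ (L : Equiv.Perm (Fin a)) (R : Equiv.Perm (Fin b)), Av L ∧ Av R ∧ glue h L R = σ := by
  have hlt : ∀ i : Fin N, (i : ℕ) ≠ a → (σ i : ℕ) < a + b := by
    intro i hi
    have h1 := (σ i).2
    have h2 : (σ i : ℕ) ≠ a + b := by
      intro h3
      have := σ.injective (Fin.ext (h3.trans hmax.symm))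
      exact hi (by rw [this])
    omega
  have key : ∀ i j : Fin N, (i : ℕ) < a → a < (j : ℕ) → σ j < σ i := by
    intro i j hi hj
    by_contra hcon
    have h1 : σ i < σ j := lt_of_le_of_ne (not_lt.1 hcon) (fun he => by
      have := σ.injective he
      rw [this] at hi; omega)
    refine hσ i ⟨a, by omega⟩ j (Fin.lt_def.2 hi) (Fin.lt_def.2 hj) ⟨h1, Fin.lt_def.2 ?_⟩
    rw [hmax]; exact hlt j (by omega)
  have hlo : ∀ i : Fin N, (i : ℕ) < a → b ≤ (σ i : ℕ) := by
    intro i hi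
    have : (Finset.univ : Finset (Fin b)).card ≤ (Finset.range (σ i)).card := by
      refine Finset.card_le_card_of_injOn (fun t => (σ ⟨t + a + 1, by have := t.2; omega⟩ : ℕ)) ?_ ?_
      · intro t _
        simp only [Finset.coe_range, Set.mem_Iio]
        exact key i _ hi (by simp only; omega)
      · intro t _ t' _ htt
        have := σ.injective (Fin.ext htt)
        simp only [Fin.mk.injEq] at this
        exact Fin.ext (by omega)
    simpa using this
  have hhi : ∀ j : Fin N, a < (j : ℕ) → (σ j : ℕ) < b := by
    intro j hj
    have : (Finset.univ : Finset (Fin (a + 1))).card ≤ (Finset.Ioo (σ j : ℕ) N).card := by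
      refine Finset.card_le_card_of_injOn (fun t => (σ ⟨t, by have := t.2; omega⟩ : ℕ)) ?_ ?_
      · intro t _
        simp only [Finset.coe_Ioo, Set.mem_Ioo]
        refine ⟨?_, Fin.is_lt _⟩
        rcases Nat.lt_or_ge t a with ht | ht
        · exact key _ j ht hj
        · have : (t : ℕ) = a := by have := t.2; omega
          simp only [this, hmax]
          exact hlt j (by omega)
      · intro t _ t' _ htt
        have := σ.injective (Fin.ext htt)
        simp only [Fin.mk.injEq] at this
        exact Fin.ext this
    simp at this
    omega
  have hLinj : Function.Injective (fun i : Fin a => (⟨σ ⟨i, by have := i.2; omega⟩ - b, by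
      have := i.2
      have h1 := hlt ⟨i, by omega⟩ (by simp only; omega)
      have h2 := hlo ⟨i, by omega⟩ i.2
      omega⟩ : Fin a)) := by
    intro i j hij
    have hi := i.2
    have hj := j.2
    have h1 := hlo ⟨i, by omega⟩ i.2
    have h2 := hlo ⟨j, by omega⟩ j.2
    simp only [Fin.mk.injEq] at hij
    have := σ.injective (Fin.ext (by omega) : σ ⟨i, by omega⟩ = σ ⟨j, by omega⟩)
    simp only [Fin.mk.injEq] at this
    exact Fin.ext this
  have hRinj : Function.Injective (fun i : Fin b => (⟨σ ⟨i + a + 1, by have := i.2; omega⟩,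
      hhi _ (by simp only; omega)⟩ : Fin b)) := by
    intro i j hij
    have hi := i.2
    have hj := j.2
    simp only [Fin.mk.injEq] at hij
    have := σ.injective (Fin.ext hij)
    simp only [Fin.mk.injEq] at this
    exact Fin.ext (by omega)
  refine ⟨Equiv.ofBijective _ (Finite.injective_iff_bijective.1 hLinj),
    Equiv.ofBijective _ (Finite.injective_iff_bijective.1 hRinj), ?_, ?_, ?_⟩
  · intro i j k hij hjk hh
    simp only [Equiv.ofBijective_apply, Fin.lt_def] at hh
    have hi := i.2
    have hj := j.2
    have hk := k.2
    have h1 := hlo ⟨i, by omega⟩ i.2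
    have h2 := hlo ⟨j, by omega⟩ j.2
    have h3 := hlo ⟨k, by omega⟩ k.2
    exact hσ ⟨i, by omega⟩ ⟨j, by omega⟩ ⟨k, by omega⟩ hij hjk
      ⟨Fin.lt_def.2 (by omega), Fin.lt_def.2 (by omega)⟩
  · intro i j k hij hjk hh
    simp only [Equiv.ofBijective_apply, Fin.lt_def] at hh hij hjk
    have hi := i.2
    have hj := j.2
    have hk := k.2
    exact hσ ⟨i + a + 1, by omega⟩ ⟨j + a + 1, by omega⟩ ⟨k + a + 1, by omega⟩
      (Fin.lt_def.2 (by simp only; omega)) (Fin.lt_def.2 (by simp only; omega))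
      ⟨Fin.lt_def.2 hh.1, Fin.lt_def.2 hh.2⟩
  · refine Equiv.ext fun i => Fin.ext ?_
    rw [glue_apply]
    rcases lt_trichotomy (i : ℕ) a with hi | hi | hi
    · rw [glueFun_lt _ _ _ i hi]
      simp only [Equiv.ofBijective_apply, Fin.eta]
      have := hlo i hi
      omega
    · rw [glueFun_eq _ _ _ i hi, ← hmax]
      congr 2
      exact Fin.ext hi.symm
    · rw [glueFun_gt _ _ _ i hi]
      simp only [Equiv.ofBijective_apply]
      congr 2
      exact Fin.ext (by simp only; omega)

theorem glue_inj {a b N : ℕ} (h : a + b + 1 = N) (L L' : Equiv.Perm (Fin a)) (R R' : Equiv.Perm (Fin b))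
    (he : glue h L R = glue h L' R') : L = L' ∧ R = R' := by
  constructor
  · refine Equiv.ext fun i => Fin.ext ?_
    have hi := i.2
    have h1 : (glueFun h L R ⟨i, by omega⟩ : ℕ) = glueFun h L' R' ⟨i, by omega⟩ := by
      rw [← glue_apply, ← glue_apply, he]
    rw [glueFun_lt h L R _ hi, glueFun_lt h L' R' _ hi] at h1
    simpa using h1
  · refine Equiv.ext fun i => Fin.ext ?_
    have hi := i.2
    have h1 : (glueFun h L R ⟨i + a + 1, by omega⟩ : ℕ) = glueFun h L' R' ⟨i + a + 1, by omega⟩ := by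
      rw [← glue_apply, ← glue_apply, he]
    rw [glueFun_gt h L R _ (by simp only; omega), glueFun_gt h L' R' _ (by simp only; omega)] at h1
    have e : (⟨(i : ℕ) + a + 1 - a - 1, by omega⟩ : Fin b) = i := Fin.ext (by simp only; omega)
    simp only [e] at h1
    exact h1

open Classical in
theorem card_glue {a b N : ℕ} (h : a + b + 1 = N) (P : Equiv.Perm (Fin N) → Prop) :
    (Finset.univ.filter fun σ : Equiv.Perm (Fin N) => (Av σ ∧ P σ) ∧ (σ ⟨a, by omega⟩ : ℕ) = a + b).card
    = (Finset.univ.filter fun p : Equiv.Perm (Fin a) × Equiv.Perm (Fin b) =>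
        Av p.1 ∧ Av p.2 ∧ P (glue h p.1 p.2)).card := by
  symm
  refine Finset.card_bij (fun p _ => glue h p.1 p.2) ?_ ?_ ?_
  · intro p hp
    simp only [Finset.mem_filter, Finset.mem_univ, true_and] at hp ⊢
    exact ⟨⟨glue_av h _ _ hp.1 hp.2.1, hp.2.2⟩, by rw [glue_apply]; exact glueFun_eq h _ _ _ rfl⟩
  · intro p _ q _ he
    have := glue_inj h _ _ _ _ he
    exact Prod.ext this.1 this.2
  · intro σ hσ
    simp only [Finset.mem_filter, Finset.mem_univ, true_and] at hσ
    obtain ⟨L, R, hL, hR, he⟩ := glue_surj h σ hσ.1.1 hσ.2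
    refine ⟨(L, R), ?_, he⟩
    simp only [Finset.mem_filter, Finset.mem_univ, true_and]
    exact ⟨hL, hR, he ▸ hσ.1.2⟩

open Classical in
theorem card_split (n : ℕ) (P : Equiv.Perm (Fin (n + 1)) → Prop) (f : ℕ → ℕ → ℕ)
    (hf : ∀ a b (h : a + b + 1 = n + 1), (Finset.univ.filter fun p : Equiv.Perm (Fin a) × Equiv.Perm (Fin b) =>
        Av p.1 ∧ Av p.2 ∧ P (glue h p.1 p.2)).card = f a b) :
    (Finset.univ.filter fun σ : Equiv.Perm (Fin (n + 1)) => Av σ ∧ P σ).card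
    = ∑ a ∈ Finset.range (n + 1), f a (n - a) := by
  rw [Finset.card_eq_sum_card_fiberwise (f := fun σ => ((σ.symm (Fin.last n) : Fin (n + 1)) : ℕ))
    (t := Finset.range (n + 1))]
  · refine Finset.sum_congr rfl fun a ha => ?_
    have ha' := Finset.mem_range.1 ha
    have h : a + (n - a) + 1 = n + 1 := by omega
    rw [← hf a (n - a) h, ← card_glue h P, Finset.filter_filter]
    congr 1
    ext σ
    simp only [Finset.mem_filter, Finset.mem_univ, true_and, and_congr_right_iff]
    intro _
    constructor
    · intro hs
      have : (⟨a, by omega⟩ : Fin (n + 1)) = σ.symm (Fin.last n) := Fin.ext hs.symm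
      rw [this, Equiv.apply_symm_apply, Fin.val_last]; omega
    · intro hs
      have : σ ⟨a, by omega⟩ = Fin.last n := Fin.ext (by rw [hs, Fin.val_last]; omega)
      rw [← this, Equiv.symm_apply_apply]
  · intro σ _
    simp only [Finset.coe_range, Set.mem_Iio]
    exact Fin.is_lt _

open Classical in
/-- number of 132-avoiders -/
noncomputable def cntA (n : ℕ) : ℕ := (Finset.univ.filter fun σ : Equiv.Perm (Fin n) => Av σ).card

/-- point at distance `x` from the right and `y` from the top -/
def Pt {n : ℕ} (x y : ℕ) (σ : Equiv.Perm (Fin n)) : Prop :=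
  ∃ i : Fin n, (i : ℕ) + 1 + x = n ∧ (σ i : ℕ) + 1 + y = n

open Classical in
/-- number of 132-avoiders through a point -/
noncomputable def cntF (n x y : ℕ) : ℕ :=
  (Finset.univ.filter fun σ : Equiv.Perm (Fin n) => Av σ ∧ Pt x y σ).card

theorem cntA_eq (n : ℕ) : cntA n = catalan n := by
  classical
  induction n using Nat.strong_induction_on with
  | _ n ih =>
  cases n with
  | zero =>
    rw [catalan_zero, cntA, Finset.filter_true_of_mem]
    · simp
    · intro σ _ i; exact i.elim0
  | succ n =>
    have := card_split n (fun _ => True) (fun a b => cntA a * cntA b) (by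
      intro a b h
      simp only [and_true, cntA]
      rw [← Finset.card_product]
      congr 1
      ext p
      simp)
    simp only [and_true] at this
    rw [catalan_succ', Finset.Nat.sum_antidiagonal_eq_sum_range_succ_mk]
    unfold cntA at this ⊢
    rw [this]
    refine Finset.sum_congr rfl fun a ha => ?_
    have ha' := Finset.mem_range.1 ha
    have e1 := ih a (by omega)
    have e2 := ih (n - a) (by omega)
    unfold cntA at e1 e2
    rw [e1, e2]

theorem pt_glue_eq {a b N : ℕ} (h : a + b + 1 = N) (L : Equiv.Perm (Fin a)) (R : Equiv.Perm (Fin b)) (y : ℕ) :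
    Pt b y (glue h L R) ↔ y = 0 := by
  constructor
  · rintro ⟨i, h1, h2⟩
    rw [glue_apply, glueFun_eq h L R i (by omega)] at h2
    omega
  · intro hy
    refine ⟨⟨a, by omega⟩, by simp only; omega, ?_⟩
    rw [glue_apply, glueFun_eq h L R _ rfl]
    omega

theorem pt_glue_lt {a b N : ℕ} (h : a + b + 1 = N) (L : Equiv.Perm (Fin a)) (R : Equiv.Perm (Fin b)) (x y : ℕ)
    (hx : b < x) : Pt x y (glue h L R) ↔ 1 ≤ y ∧ Pt (x - 1 - b) (y - 1) L := by
  constructor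
  · rintro ⟨i, h1, h2⟩
    have hi : (i : ℕ) < a := by omega
    rw [glue_apply, glueFun_lt h L R i hi] at h2
    have := (L ⟨i, hi⟩).2
    exact ⟨by omega, ⟨i, hi⟩, by simp only; omega, by omega⟩
  · rintro ⟨hy, i, h1, h2⟩
    have hi := i.2
    refine ⟨⟨i, by omega⟩, by simp only; omega, ?_⟩
    rw [glue_apply, glueFun_lt h L R _ hi]
    simp only [Fin.eta]
    omega

theorem pt_glue_gt {a b N : ℕ} (h : a + b + 1 = N) (L : Equiv.Perm (Fin a)) (R : Equiv.Perm (Fin b)) (x y : ℕ)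
    (hx : x < b) : Pt x y (glue h L R) ↔ a + 1 ≤ y ∧ Pt x (y - 1 - a) R := by
  constructor
  · rintro ⟨i, h1, h2⟩
    have hi : a < (i : ℕ) := by omega
    have hi2 := i.2
    rw [glue_apply, glueFun_gt h L R i hi] at h2
    have := (R ⟨i - a - 1, by omega⟩).2
    exact ⟨by omega, ⟨i - a - 1, by omega⟩, by simp only; omega, by omega⟩
  · rintro ⟨hy, i, h1, h2⟩
    have hi := i.2
    refine ⟨⟨i + a + 1, by omega⟩, by simp only; omega, ?_⟩
    rw [glue_apply, glueFun_gt h L R _ (by simp only; omega)]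
    have e : (⟨(i : ℕ) + a + 1 - a - 1, by omega⟩ : Fin b) = i := Fin.ext (by simp only; omega)
    simp only [e]
    omega

theorem cntF_rec (n x y : ℕ) : cntF (n + 1) x y = ∑ a ∈ Finset.range (n + 1),
    (if x = n - a then (if y = 0 then catalan a * catalan (n - a) else 0)
     else if n - a < x then (if 1 ≤ y then catalan (n - a) * cntF a (x - 1 - (n - a)) (y - 1) else 0)
     else if a + 1 ≤ y then catalan a * cntF (n - a) x (y - 1 - a) else 0) := by
  classical
  have := card_split n (Pt x y) (fun a b =>
    (if x = b then (if y = 0 then catalan a * catalan b else 0)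
     else if b < x then (if 1 ≤ y then catalan b * cntF a (x - 1 - b) (y - 1) else 0)
     else if a + 1 ≤ y then catalan a * cntF b x (y - 1 - a) else 0)) (by
    intro a b h
    split_ifs with h1 h2 h3 h4 h5
    · subst h1
      simp only [pt_glue_eq, h2, and_true]
      rw [← cntA_eq, ← cntA_eq, cntA, cntA, ← Finset.card_product]
      congr 1
      ext p
      simp
    · subst h1
      simp [pt_glue_eq, h2]
    · simp only [pt_glue_lt h _ _ x y h3, h4, true_and]
      rw [← cntA_eq, cntA, cntF, mul_comm, ← Finset.card_product]
      congr 1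
      ext p
      simp
      tauto
    · simp [pt_glue_lt h _ _ x y h3, h4]
    · simp only [pt_glue_gt h _ _ x y (by omega), h5, true_and]
      rw [← cntA_eq, cntA, cntF, ← Finset.card_product]
      congr 1
      ext p
      simp
    · simp [pt_glue_gt h _ _ x y (by omega), h5])
  rw [← this, cntF]

theorem cntF_zero (n x : ℕ) (hx : x ≤ n) : cntF (n + 1) x 0 = catalan x * catalan (n - x) := by
  rw [cntF_rec, Finset.sum_eq_single (n - x)]
  · rw [show n - (n - x) = x by omega]
    simp [mul_comm]
  · intro a ha hne
    have ha' := Finset.mem_range.1 ha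
    rw [if_neg (by omega)]
    simp
  · intro hh
    simp at hh

theorem cntF_succ (n x y : ℕ) (hx : x + y < n) : cntF (n + 1) x (y + 1) =
      ∑ b ∈ Finset.range x, catalan b * cntF (n - b) (x - 1 - b) y
      + ∑ a ∈ Finset.range (y + 1), catalan a * cntF (n - a) x (y - a) := by
  have e1 : ∑ b ∈ Finset.range x, catalan b * cntF (n - b) (x - 1 - b) y =
      ∑ b ∈ Finset.range (n + 1), if b < x then catalan b * cntF (n - b) (x - 1 - b) y else 0 := by
    rw [← Finset.sum_filter]
    refine Finset.sum_congr ?_ fun _ _ => rfl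
    ext b
    simp only [Finset.mem_range, Finset.mem_filter]
    omega
  have e2 : ∑ a ∈ Finset.range (y + 1), catalan a * cntF (n - a) x (y - a) =
      ∑ a ∈ Finset.range (n + 1), if a < y + 1 then catalan a * cntF (n - a) x (y - a) else 0 := by
    rw [← Finset.sum_filter]
    refine Finset.sum_congr ?_ fun _ _ => rfl
    ext b
    simp only [Finset.mem_range, Finset.mem_filter]
    omega
  rw [e1, e2, ← Finset.sum_range_reflect, ← Finset.sum_add_distrib, cntF_rec]
  refine Finset.sum_congr rfl fun a ha => ?_
  have ha' := Finset.mem_range.1 ha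
  rw [show n + 1 - 1 - a = n - a by omega, show n - (n - a) = a by omega,
    show y + 1 - 1 - a = y - a by omega, show y + 1 - 1 = y by omega]
  rcases lt_trichotomy x (n - a) with h | h | h
  · rw [if_neg (by omega), if_neg (by omega), if_neg (by omega : ¬ n - a < x), zero_add]
    by_cases hy : a < y + 1
    · rw [if_pos hy, if_pos (by omega)]
    · rw [if_neg hy, if_neg (by omega)]
  · rw [if_pos h, if_neg (by omega), if_neg (by omega), if_neg (by omega)]
  · rw [if_neg (by omega), if_pos h, if_pos (by omega), if_pos h, if_neg (by omega), add_zero]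

theorem Qcount_eq (n c : ℕ) (h : c < n) : Qcount n (n - c) (n - c) = cntF n c c := by
  classical
  unfold Qcount cntF
  rw [Nat.card_eq_fintype_card, Fintype.card_subtype]
  congr 1
  ext σ
  simp only [Finset.mem_filter, Finset.mem_univ, true_and]
  rw [avoids_iff, Pt]
  refine and_congr_right fun _ => exists_congr fun i => ?_
  omega

/-- For a fixed integer `c ≥ 0`,
`Q_n(n-c, n-c)/C_n → Σ_{s=0}^{c} ((s+1)/(2c+1-s))² C(2c+1-s, c+1)² 4^{s-2c-1}`. -/
theorem Qcount_corner_limit (c : ℕ) :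
    Tendsto (fun n : ℕ => (Qcount n (n - c) (n - c) : ℝ) / (catalan n : ℝ))
      atTop
      (nhds (∑ s ∈ Finset.range (c + 1),
        (((s : ℝ) + 1) / (2 * (c : ℝ) + 1 - s)) ^ 2 *
          (Nat.choose (2 * c + 1 - s) (c + 1) : ℝ) ^ 2 *
          (4 : ℝ) ^ ((s : ℤ) - 2 * (c : ℤ) - 1))) := by
  rw [← limG_closed]
  refine (limit_of_rec cntF cntF_zero cntF_succ c c).congr' ?_
  filter_upwards [eventually_gt_atTop c] with n hn
  rw [Qcount_eq n c hn]
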